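/- For Im τ > 0, the translated Weierstrass function ℘̃_τ of the lattice ℤ + τℤ satisfies, for z = α + βτ with α, β ∈ ℝ and |β| < 1/2: ℘̃_τ(z) = 4iπ² (Σ_{n=1}^∞ (-1)^n n/sin(nπτ) − Σ_{n=1}^∞ (-1)^n n cos(2nπz)/sin(nπτ)). -/

import Mathlib

open scoped Real

/-- The Weierstrass ℘-function of the lattice `ℤ + τℤ`. -/
noncomputable def wp (τ : ℂ) (z : ℂ) : ℂ :=
  1 / z ^ 2 + ∑' p : ℤ × ℤ,
    if p = 0 then 0 else
      (1 / (z + (p.1 : ℂ) + (p.2 : ℂ) * τ) ^ 2 - 1 / ((p.1 : ℂ) + (p.2 : ℂ) * τ) ^ 2)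

/-- The translated Weierstrass function `℘̃_τ(z) = ℘_τ(z + (1+τ)/2) − ℘_τ((1+τ)/2)`. -/
noncomputable def wpTilde (τ : ℂ) (z : ℂ) : ℂ :=
  wp τ (z + (1 + τ) / 2) - wp τ ((1 + τ) / 2)

/-- Summing a Lambert-type double series row by row and column by column. -/
theorem hasSum_lambert {Q s : ℂ} (hQ : ‖Q‖ < 1) (hs : ‖s‖ < 1) :
    Summable (fun k : ℕ ↦ ((k : ℂ) + 1) * (Q ^ (k + 1) / (1 - s ^ (k + 1)))) ∧
    HasSum (fun n : ℕ ↦ ∑' k : ℕ, ((k : ℂ) + 1) * (Q * s ^ n) ^ (k + 1))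
      (∑' k : ℕ, ((k : ℂ) + 1) * (Q ^ (k + 1) / (1 - s ^ (k + 1)))) := by
  have hsum : Summable fun p : ℕ × ℕ ↦ ((p.1 : ℂ) + 1) * (Q * s ^ p.2) ^ (p.1 + 1) := by
    have h₁ : Summable fun k : ℕ ↦ ((k : ℝ) + 1) * ‖Q‖ ^ (k + 1) := by
      have := summable_pow_mul_geometric_of_norm_lt_one (R := ℝ) 1 (r := ‖Q‖) (by simpa using hQ)
      simpa using (summable_nat_add_iff 1).2 this
    have h₂ : Summable fun n : ℕ ↦ ‖s‖ ^ n := summable_geometric_of_lt_one (norm_nonneg _) hs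
    refine Summable.of_norm_bounded (h₁.mul_of_nonneg h₂ (fun _ ↦ by positivity)
      (fun _ ↦ by positivity)) fun ⟨k, n⟩ ↦ ?_
    have hk : ‖(k : ℂ) + 1‖ = (k : ℝ) + 1 := by
      exact_mod_cast Complex.norm_natCast (k + 1)
    have hpow : (‖s‖ ^ n) ^ (k + 1) ≤ ‖s‖ ^ n :=
      pow_le_of_le_one (by positivity) (pow_le_one₀ (norm_nonneg _) hs.le) (by simp)
    simp only [norm_mul, norm_pow, hk, mul_pow, ← mul_assoc]
    gcongr
  have hcol (k : ℕ) : HasSum (fun n : ℕ ↦ ((k : ℂ) + 1) * (Q * s ^ n) ^ (k + 1))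
      (((k : ℂ) + 1) * (Q ^ (k + 1) / (1 - s ^ (k + 1)))) := by
    have hs' : ‖s ^ (k + 1)‖ < 1 := by
      rw [norm_pow]; exact pow_lt_one₀ (norm_nonneg _) hs (by simp)
    have := ((hasSum_geometric_of_norm_lt_one hs').mul_left (Q ^ (k + 1))).mul_left ((k : ℂ) + 1)
    rw [← div_eq_mul_inv] at this
    refine this.congr_fun fun n ↦ ?_
    rw [mul_pow, ← pow_mul, ← pow_mul, mul_comm n]
  have htot := hsum.hasSum.prod_fiberwise hcol
  refine ⟨htot.summable, ?_⟩
  rw [htot.tsum_eq]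
  have hswap := (Equiv.prodComm ℕ ℕ).hasSum_iff.2 hsum.hasSum
  exact hswap.prod_fiberwise fun n ↦ (hswap.summable.prod_factor n).hasSum

/-- Lipschitz's formula for the exponent two. -/
theorem tsum_one_div_add_int_sq {w : ℂ} (hw : 0 < w.im) :
    ∑' m : ℤ, 1 / (w + m) ^ 2 =
      -4 * (π : ℂ) ^ 2 * ∑' k : ℕ, ((k : ℂ) + 1) * Complex.exp (2 * π * Complex.I * w) ^ (k + 1) := by
  have h := EisensteinSeries.qExpansion_identity_pnat (k := 1) le_rfl ⟨w, hw⟩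
  rw [tsum_pnat_eq_tsum_succ
    (f := fun n : ℕ ↦ (n : ℂ) ^ 1 * Complex.exp (2 * π * Complex.I * w) ^ n)] at h
  simp only [Nat.cast_add, Nat.cast_one, pow_one, Nat.reduceAdd] at h
  refine h.trans ?_
  congr 1
  simp [mul_pow, Complex.I_sq]
  ring

theorem tsum_one_div_neg_add_int_sq (w : ℂ) :
    ∑' m : ℤ, 1 / (-w + m) ^ 2 = ∑' m : ℤ, 1 / (w + m) ^ 2 := by
  rw [← (Equiv.neg ℤ).tsum_eq]
  refine tsum_congr fun m ↦ ?_
  simp only [Equiv.neg_apply, Int.cast_neg]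
  rw [← neg_add, neg_sq]

theorem tsum_one_div_add_one_add_int_sq (w : ℂ) :
    ∑' m : ℤ, 1 / (w + 1 + m) ^ 2 = ∑' m : ℤ, 1 / (w + m) ^ 2 := by
  rw [← (Equiv.addLeft (1 : ℤ)).tsum_eq fun m : ℤ ↦ 1 / (w + m) ^ 2]
  refine tsum_congr fun m ↦ ?_
  simp [add_assoc]

/-- The defining series of `wp`, with the term `1 / z ^ 2` reinserted at the origin. -/
theorem hasSum_wp {τ : ℂ} (hτ : 0 < τ.im) (z : ℂ) :
    HasSum (fun p : ℤ × ℤ ↦ 1 / (z + (p.1 : ℂ) + (p.2 : ℂ) * τ) ^ 2 -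
      1 / ((p.1 : ℂ) + (p.2 : ℂ) * τ) ^ 2) (wp τ z) := by
  have hind : LinearIndependent ℝ ![(1 : ℂ), τ] := by
    rw [LinearIndependent.pair_iff]
    intro a b h
    have hb : b = 0 := by simpa [hτ.ne'] using congrArg Complex.im h
    exact ⟨by simpa [hb] using congrArg Complex.re h, hb⟩
  let L : PeriodPair := ⟨1, τ, hind⟩
  have hs : Summable fun p : ℤ × ℤ ↦ 1 / (z + (p.1 : ℂ) + (p.2 : ℂ) * τ) ^ 2 -
      1 / ((p.1 : ℂ) + (p.2 : ℂ) * τ) ^ 2 := by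
    have h := L.latticeEquivProd.symm.toEquiv.summable_iff.2 (L.hasSum_weierstrassP (-z)).summable
    refine h.congr fun p ↦ ?_
    have hp : ((L.latticeEquivProd.symm p : L.lattice) : ℂ) = p.1 + p.2 * τ := by
      rw [L.latticeEquiv_symm_apply]; simp [L]
    simp only [Function.comp_apply, LinearEquiv.coe_toEquiv, hp]
    congr 2
    ring
  convert hs.hasSum using 1
  rw [hs.tsum_eq_add_tsum_ite 0, wp]
  simp

theorem norm_exp_two_pi_I_mul_lt_one {w : ℂ} (hw : 0 < w.im) :
    ‖Complex.exp (2 * π * Complex.I * w)‖ < 1 :=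
  UpperHalfPlane.norm_exp_two_pi_I_lt_one ⟨w, hw⟩

theorem exp_div_one_sub_exp_eq {τ : ℂ} (hτ : 0 < τ.im) (u : ℂ) (k : ℕ) :
    Complex.exp (2 * π * Complex.I * (u + (1 + τ) / 2)) ^ (k + 1) /
        (1 - Complex.exp (2 * π * Complex.I * τ) ^ (k + 1)) =
      (-1) ^ (k + 1) * Complex.exp (2 * ((k : ℂ) + 1) * π * u * Complex.I) * Complex.I /
        (2 * Complex.sin (((k : ℂ) + 1) * π * τ)) := by
  set x := ((k : ℂ) + 1) * π * τ with hx
  have hE : Complex.exp (2 * π * Complex.I * τ) ^ (k + 1) =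
      Complex.exp (x * Complex.I) * Complex.exp (x * Complex.I) := by
    rw [← Complex.exp_nat_mul, ← Complex.exp_add]; congr 1; push_cast; rw [hx]; ring
  have hN : Complex.exp (2 * π * Complex.I * (u + (1 + τ) / 2)) ^ (k + 1) =
      (-1) ^ (k + 1) * Complex.exp (2 * ((k : ℂ) + 1) * π * u * Complex.I) *
        Complex.exp (x * Complex.I) := by
    rw [← Complex.exp_pi_mul_I, ← Complex.exp_nat_mul, ← Complex.exp_nat_mul, ← Complex.exp_add,
      ← Complex.exp_add]
    congr 1; push_cast; rw [hx]; ring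
  have hne : 1 - Complex.exp (x * Complex.I) * Complex.exp (x * Complex.I) ≠ 0 := by
    rw [← hE, sub_ne_zero]
    intro h
    have := pow_lt_one₀ (norm_nonneg _) (norm_exp_two_pi_I_mul_lt_one hτ) (Nat.succ_ne_zero k)
    rw [← norm_pow, Nat.succ_eq_add_one, ← h] at this
    simp at this
  rw [hE, hN, Complex.sin, neg_mul, Complex.exp_neg]
  have he := Complex.exp_ne_zero (x * Complex.I)
  generalize Complex.exp (x * Complex.I) = e at *
  have hne' : e⁻¹ - e ≠ 0 := by
    intro h
    apply hne
    have : e * (e⁻¹ - e) = 0 := by rw [h, mul_zero]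
    rwa [mul_sub, mul_inv_cancel₀ he] at this
  have h2 : 1 - e * e = e * (e⁻¹ - e) := by rw [mul_sub, mul_inv_cancel₀ he]
  rw [h2]
  field_simp

theorem hasSum_rows_nat {τ : ℂ} (hτ : 0 < τ.im) {u : ℂ} (hu : 0 < (u + (1 + τ) / 2).im) :
    Summable (fun k : ℕ ↦ ((k : ℂ) + 1) * ((-1) ^ (k + 1) *
      Complex.exp (2 * ((k : ℂ) + 1) * π * u * Complex.I) * Complex.I /
        (2 * Complex.sin (((k : ℂ) + 1) * π * τ)))) ∧
    HasSum (fun n : ℕ ↦ ∑' m : ℤ, 1 / (u + (1 + τ) / 2 + n * τ + m) ^ 2)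
      (-4 * (π : ℂ) ^ 2 * ∑' k : ℕ, ((k : ℂ) + 1) * ((-1) ^ (k + 1) *
        Complex.exp (2 * ((k : ℂ) + 1) * π * u * Complex.I) * Complex.I /
          (2 * Complex.sin (((k : ℂ) + 1) * π * τ)))) := by
  obtain ⟨h₁, h₂⟩ := hasSum_lambert (norm_exp_two_pi_I_mul_lt_one hu)
    (norm_exp_two_pi_I_mul_lt_one hτ)
  simp only [exp_div_one_sub_exp_eq hτ] at h₁ h₂
  refine ⟨h₁, ?_⟩
  refine (h₂.mul_left (-4 * (π : ℂ) ^ 2)).congr_fun fun n ↦ ?_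
  have him : 0 < (u + (1 + τ) / 2 + n * τ).im := by
    have : 0 ≤ (n : ℝ) * τ.im := by positivity
    rw [Complex.add_im]
    simpa using add_pos_of_pos_of_nonneg hu this
  rw [tsum_one_div_add_int_sq him, ← Complex.exp_nat_mul, ← Complex.exp_add]
  congr 6 with k
  congr 3
  ring

theorem hasSum_rows_int {τ : ℂ} (hτ : 0 < τ.im) {z : ℂ} (hz : 0 < (z + (1 + τ) / 2).im)
    (hz' : 0 < (-z + (1 + τ) / 2).im) :
    HasSum (fun n : ℤ ↦ ∑' m : ℤ, 1 / (z + (1 + τ) / 2 + n * τ + m) ^ 2)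
      (-4 * Complex.I * (π : ℂ) ^ 2 * ∑' k : ℕ, (-1 : ℂ) ^ (k + 1) * ((k : ℂ) + 1) *
        Complex.cos (2 * ((k : ℂ) + 1) * π * z) / Complex.sin (((k : ℂ) + 1) * π * τ)) := by
  obtain ⟨hs, h⟩ := hasSum_rows_nat hτ hz
  obtain ⟨hs', h'⟩ := hasSum_rows_nat hτ hz'
  have key := HasSum.of_nat_of_neg_add_one
    (f := fun n : ℤ ↦ ∑' m : ℤ, 1 / (z + (1 + τ) / 2 + n * τ + m) ^ 2)
    (by simpa only [Int.cast_natCast] using h) (h'.congr_fun fun n ↦ ?_)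
  · convert key using 1
    rw [← mul_add, ← hs.tsum_add hs', ← tsum_mul_left, ← tsum_mul_left]
    refine tsum_congr fun k ↦ ?_
    rw [Complex.cos, mul_neg, neg_mul]
    generalize Complex.exp _ = a
    ring
  · rw [← tsum_one_div_neg_add_int_sq, ← tsum_one_div_add_one_add_int_sq]
    refine tsum_congr fun m ↦ ?_
    push_cast
    ring_nf

theorem summable_one_div_add_int_sq (w : ℂ) : Summable fun m : ℤ ↦ 1 / (w + m) ^ 2 := by
  have := EisensteinSeries.linear_right_summable w 1 (k := 2) le_rfl
  refine this.congr fun m ↦ ?_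
  simp

theorem stmt9 (τ : ℂ) (hτ : 0 < τ.im) (α β : ℝ) (hβ : |β| < 1/2) :
    wpTilde τ ((α : ℂ) + (β : ℂ) * τ) = 4 * Complex.I * (π : ℂ) ^ 2 *
      ((∑' n : ℕ, (-1 : ℂ) ^ (n + 1) * ((n : ℂ) + 1) / Complex.sin (((n : ℂ) + 1) * π * τ))
        - ∑' n : ℕ, (-1 : ℂ) ^ (n + 1) * ((n : ℂ) + 1) *
            Complex.cos (2 * ((n : ℂ) + 1) * π * ((α : ℂ) + (β : ℂ) * τ)) /
            Complex.sin (((n : ℂ) + 1) * π * τ)) := by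
  obtain ⟨hβ₁, hβ₂⟩ := abs_lt.1 hβ
  set z : ℂ := (α : ℂ) + (β : ℂ) * τ with hz
  have him : z.im = β * τ.im := by simp [hz]
  have hhalf : ((1 + τ) / 2).im = τ.im / 2 := by simp
  have hz₁ : 0 < (z + (1 + τ) / 2).im := by
    rw [Complex.add_im, him, hhalf]; nlinarith
  have hz₂ : 0 < (-z + (1 + τ) / 2).im := by
    rw [Complex.add_im, Complex.neg_im, him, hhalf]; nlinarith
  have h₀ : 0 < ((0 : ℂ) + (1 + τ) / 2).im := by
    rw [zero_add, hhalf]; linarith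
  have hrows := (hasSum_rows_int hτ hz₁ hz₂).sub
    (hasSum_rows_int hτ h₀ (by rwa [neg_zero]))
  have hwp := (Equiv.prodComm ℤ ℤ).hasSum_iff.2
    ((hasSum_wp hτ (z + (1 + τ) / 2)).sub (hasSum_wp hτ ((1 + τ) / 2)))
  have hfib := hwp.prod_fiberwise fun n ↦
    (((summable_one_div_add_int_sq (z + (1 + τ) / 2 + n * τ)).hasSum.sub
      (summable_one_div_add_int_sq (0 + (1 + τ) / 2 + n * τ)).hasSum).congr_fun fun m ↦ ?_)
  · rw [wpTilde, hfib.unique hrows]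
    simp only [mul_zero, Complex.cos_zero, mul_one]
    ring
  · simp only [Function.comp_apply, Equiv.prodComm_apply, Prod.swap_prod_mk, zero_add]
    rw [sub_sub_sub_cancel_right]
    ring_nf
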